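/- arXiv:1803.10639 — 3 statements merged into one kernel-verified Lean document; each statement's English description precedes it below -/
import Mathlib

section
/- Let V be a finite set, let {e_1, …, e_r} and {e'_1, …, e'_t} be two disjoint sets of edges (two-element subsets of V), with t ≥ 1, let 0 < p < 1, and let Q be a p-random query. Then the conditional probability Pr[ for all i ∈ [r], e_i ⊄ Q | there exists j ∈ [t] with e'_j ⊆ Q ] is at least (1 − p)^r. -/
open Finset
open scoped Classical

/-- The probability that a `p`-random query (each element included independently with
probability `p`) equals the given finite set `Q`. -/
noncomputable def qweight {V : Type} [Fintype V] (p : ℝ) (Q : Finset V) : ℝ :=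
  p ^ Q.card * (1 - p) ^ (Fintype.card V - Q.card)

/-- The probability that a `p`-random query satisfies the event `A`. -/
noncomputable def qprob {V : Type} [Fintype V] (p : ℝ) (A : Finset V → Prop) : ℝ :=
  ∑ Q : Finset V, if A Q then qweight p Q else 0

section RandomQuery

variable {V : Type} [Fintype V] {p : ℝ}

lemma qweight_pos (hp0 : 0 < p) (hp1 : p < 1) (Q : Finset V) : 0 < qweight p Q :=
  mul_pos (pow_pos hp0 _) (pow_pos (sub_pos.2 hp1) _)

lemma qweight_mul_qweight (A B : Finset V) :
    qweight p A * qweight p B = qweight p (A ∩ B) * qweight p (A ∪ B) := by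
  have hcard := card_union_add_card_inter A B
  have hA := card_le_univ A
  have hB := card_le_univ B
  have hI := card_le_univ (A ∩ B)
  have hU := card_le_univ (A ∪ B)
  unfold qweight
  rw [mul_mul_mul_comm, mul_mul_mul_comm (p ^ #(A ∩ B)), ← pow_add, ← pow_add, ← pow_add, ← pow_add]
  congr 2 <;> omega

lemma qweight_insert {v : V} {Q : Finset V} (hv : v ∉ Q) :
    (1 - p) * qweight p (insert v Q) = p * qweight p Q := by
  have hle := card_le_univ (insert v Q)
  rw [card_insert_of_notMem hv] at hle
  unfold qweight
  rw [card_insert_of_notMem hv,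
    show Fintype.card V - #Q = Fintype.card V - (#Q + 1) + 1 by omega]
  ring

lemma qprob_mono (hp0 : 0 < p) (hp1 : p < 1) {A B : Finset V → Prop} (h : ∀ Q, A Q → B Q) :
    qprob p A ≤ qprob p B := by
  refine sum_le_sum fun Q _ => ?_
  have := (qweight_pos hp0 hp1 Q).le
  split_ifs with hA hB
  · exact le_rfl
  · exact absurd (h Q hA) hB
  · exact this
  · exact le_rfl

lemma qprob_nonneg (hp0 : 0 < p) (hp1 : p < 1) (A : Finset V → Prop) : 0 ≤ qprob p A :=
  sum_nonneg fun Q _ => by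
    have := (qweight_pos hp0 hp1 Q).le
    split_ifs <;> simp [this]

lemma qprob_pos (hp0 : 0 < p) (hp1 : p < 1) {A : Finset V → Prop} (h : ∃ Q, A Q) :
    0 < qprob p A := by
  obtain ⟨Q, hQ⟩ := h
  refine sum_pos' (fun Q _ => ?_) ⟨Q, mem_univ _, ?_⟩
  · have := (qweight_pos hp0 hp1 Q).le
    split_ifs <;> simp [this]
  · simpa [hQ] using qweight_pos hp0 hp1 Q

lemma qprob_split (A B : Finset V → Prop) :
    qprob p A = qprob p (fun Q => A Q ∧ B Q) + qprob p (fun Q => A Q ∧ ¬ B Q) := by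
  unfold qprob
  rw [← sum_add_distrib]
  refine sum_congr rfl fun Q _ => ?_
  by_cases hA : A Q <;> by_cases hB : B Q <;> simp [hA, hB]

/-- Harris inequality for two decreasing events, conditionally on the query containing `s`. -/
lemma qprob_mul_qprob_le (hp0 : 0 < p) (hp1 : p < 1) (s : Finset V) {A B : Finset V → Prop}
    (hA : Antitone A) (hB : Antitone B) :
    qprob p (fun Q => s ⊆ Q ∧ A Q) * qprob p (fun Q => s ⊆ Q ∧ B Q) ≤
      qprob p (fun Q => s ⊆ Q) * qprob p (fun Q => (s ⊆ Q ∧ A Q) ∧ B Q) := by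
  have key := fkg (μ := fun Q => if s ⊆ Q then qweight p Q else 0)
    (f := fun Q => if A Q then (0 : ℝ) else 1) (g := fun Q => if B Q then (0 : ℝ) else 1)
    (fun Q => by
      have := (qweight_pos hp0 hp1 Q).le
      dsimp only
      split_ifs <;> simp [this])
    (fun Q => by dsimp only; split_ifs <;> simp)
    (fun Q => by dsimp only; split_ifs <;> simp)
    (fun Q R h => by
      have := @hA Q R h
      dsimp only
      split_ifs with h1 h2 h2 <;> simp_all)
    (fun Q R h => by
      have := @hB Q R h
      dsimp only
      split_ifs with h1 h2 h2 <;> simp_all)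
    (fun Q R => by
      have hI := (qweight_pos hp0 hp1 (Q ⊓ R)).le
      have hU := (qweight_pos hp0 hp1 (Q ⊔ R)).le
      by_cases h1 : s ⊆ Q
      · by_cases h2 : s ⊆ R
        · have h3 : s ⊆ Q ⊓ R := subset_inter h1 h2
          have h4 : s ⊆ Q ⊔ R := h1.trans subset_union_left
          simp only [h1, h2, h3, h4, if_true]
          exact (qweight_mul_qweight Q R).le
        · simp only [h2, if_false, mul_zero]
          split_ifs <;> positivity
      · simp only [h1, if_false, zero_mul]
        split_ifs <;> positivity)
  have hsA := qprob_split (p := p) (fun Q => s ⊆ Q) A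
  have hsB := qprob_split (p := p) (fun Q => s ⊆ Q) B
  have hsAB := qprob_split (p := p) (fun Q => s ⊆ Q ∧ A Q) B
  have hsnAB := qprob_split (p := p) (fun Q => s ⊆ Q ∧ ¬ A Q) B
  have hsBA := qprob_split (p := p) (fun Q => s ⊆ Q ∧ B Q) A
  have hcomm : qprob p (fun Q => (s ⊆ Q ∧ B Q) ∧ A Q) =
      qprob p (fun Q => (s ⊆ Q ∧ A Q) ∧ B Q) := by
    congr 1; ext Q; tauto
  have hcomm' : qprob p (fun Q => (s ⊆ Q ∧ B Q) ∧ ¬ A Q) =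
      qprob p (fun Q => (s ⊆ Q ∧ ¬ A Q) ∧ B Q) := by
    congr 1; ext Q; tauto
  have key' : qprob p (fun Q => s ⊆ Q ∧ ¬ A Q) * qprob p (fun Q => s ⊆ Q ∧ ¬ B Q) ≤
      qprob p (fun Q => s ⊆ Q) * qprob p (fun Q => (s ⊆ Q ∧ ¬ A Q) ∧ ¬ B Q) := by
    unfold qprob
    refine (le_of_eq ?_).trans (key.trans_eq ?_) <;> congr 1 <;>
      refine sum_congr rfl fun Q _ => ?_ <;>
      by_cases h1 : s ⊆ Q <;> by_cases h2 : A Q <;> by_cases h3 : B Q <;> simp [h1, h2, h3]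
  rw [hcomm, hcomm'] at hsBA
  have hnB : qprob p (fun Q => s ⊆ Q ∧ ¬ B Q) = qprob p (fun Q => (s ⊆ Q ∧ A Q) ∧ ¬ B Q) +
      qprob p (fun Q => (s ⊆ Q ∧ ¬ A Q) ∧ ¬ B Q) := by linarith
  rw [hsA, hsAB, hsnAB, hnB] at key'
  rw [hsA, hsAB, hsnAB, hsBA]
  linarith

lemma qprob_notMem {s : Finset V} {v : V} (hv : v ∉ s) :
    qprob p (fun Q => s ⊆ Q ∧ v ∉ Q) = (1 - p) * qprob p (fun Q => s ⊆ Q) := by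
  have h : (1 - p) * qprob p (fun Q => s ⊆ Q ∧ v ∈ Q) =
      p * qprob p (fun Q => s ⊆ Q ∧ v ∉ Q) := by
    unfold qprob
    rw [mul_sum, mul_sum]
    simp only [mul_ite, mul_zero]
    rw [← sum_filter, ← sum_filter]
    refine sum_bij' (fun Q _ => Q.erase v) (fun Q _ => insert v Q) ?_ ?_ ?_ ?_ ?_
    · intro Q hQ
      simp only [mem_filter, mem_univ, true_and] at hQ ⊢
      exact ⟨subset_erase.2 ⟨hQ.1, hv⟩, notMem_erase v Q⟩
    · intro Q hQ
      simp only [mem_filter, mem_univ, true_and] at hQ ⊢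
      exact ⟨hQ.1.trans (subset_insert v Q), mem_insert_self v Q⟩
    · intro Q hQ
      exact insert_erase (mem_filter.1 hQ).2.2
    · intro Q hQ
      exact erase_insert (mem_filter.1 hQ).2.2
    · intro Q hQ
      rw [← qweight_insert (notMem_erase v Q), insert_erase (mem_filter.1 hQ).2.2]
  have hsplit := qprob_split (p := p) (fun Q => s ⊆ Q) (fun Q => v ∈ Q)
  rw [hsplit]
  linarith

lemma pow_mul_qprob_le_qprob_forall_not_subset (hp0 : 0 < p) (hp1 : p < 1) {ι : Type*}
    (e : ι → Finset V) (s : Finset V) (I : Finset ι) (hI : ∀ i ∈ I, ¬ e i ⊆ s) :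
    (1 - p) ^ #I * qprob p (fun Q => s ⊆ Q) ≤
      qprob p (fun Q => s ⊆ Q ∧ ∀ i ∈ I, ¬ e i ⊆ Q) := by
  induction I using Finset.induction_on with
  | empty => simp
  | insert a I ha ih =>
    have ih := ih fun i hi => hI i (mem_insert_of_mem hi)
    obtain ⟨v, hva, hvs⟩ := not_subset.1 (hI a (mem_insert_self a I))
    have hs : 0 < qprob p (fun Q : Finset V => s ⊆ Q) := qprob_pos hp0 hp1 ⟨s, Subset.rfl⟩
    have hfkg := qprob_mul_qprob_le hp0 hp1 s
      (A := fun Q => ∀ i ∈ I, ¬ e i ⊆ Q) (B := fun Q => ¬ e a ⊆ Q)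
      (fun Q R h hR i hi hiQ => hR i hi (hiQ.trans h)) (fun Q R h hR hQ => hR (hQ.trans h))
    have hav : (1 - p) * qprob p (fun Q => s ⊆ Q) ≤ qprob p (fun Q => s ⊆ Q ∧ ¬ e a ⊆ Q) := by
      rw [← qprob_notMem hvs]
      exact qprob_mono hp0 hp1 fun Q hQ => ⟨hQ.1, fun h => hQ.2 (h hva)⟩
    have heq : qprob p (fun Q => s ⊆ Q ∧ ∀ i ∈ insert a I, ¬ e i ⊆ Q) =
        qprob p (fun Q => (s ⊆ Q ∧ ∀ i ∈ I, ¬ e i ⊆ Q) ∧ ¬ e a ⊆ Q) := by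
      congr 1; ext Q; simp only [forall_mem_insert]; tauto
    rw [heq, card_insert_of_notMem ha]
    have hprod := mul_le_mul ih hav (mul_nonneg (sub_nonneg.2 hp1.le) hs.le)
      (qprob_nonneg hp0 hp1 _)
    refine le_of_mul_le_mul_left ?_ hs
    calc _ = (1 - p) ^ #I * qprob p (fun Q => s ⊆ Q) * ((1 - p) * qprob p (fun Q => s ⊆ Q)) := by
          ring
      _ ≤ _ := hprod.trans hfkg

lemma mul_qprob_exists_subset_le (hp0 : 0 < p) (hp1 : p < 1) {κ : Type*} {c : ℝ}
    (e' : κ → Finset V) {A : Finset V → Prop} (hA : Antitone A) (J : Finset κ)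
    (h : ∀ j ∈ J, c * qprob p (fun Q => e' j ⊆ Q) ≤ qprob p (fun Q => e' j ⊆ Q ∧ A Q)) :
    c * qprob p (fun Q => ∃ j ∈ J, e' j ⊆ Q) ≤
      qprob p (fun Q => A Q ∧ ∃ j ∈ J, e' j ⊆ Q) := by
  induction J using Finset.induction_on with
  | empty => simp [qprob]
  | insert a J ha ih =>
    have ih := ih fun j hj => h j (mem_insert_of_mem hj)
    have hs : 0 < qprob p (fun Q : Finset V => e' a ⊆ Q) := qprob_pos hp0 hp1 ⟨_, Subset.rfl⟩
    have hfkg := qprob_mul_qprob_le hp0 hp1 (e' a) (A := A)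
      (B := fun Q => ¬ ∃ j ∈ J, e' j ⊆ Q) hA
      (fun Q R hQR hR ⟨j, hj, hjQ⟩ => hR ⟨j, hj, hjQ.trans hQR⟩)
    have hstep : c * qprob p (fun Q => e' a ⊆ Q ∧ ¬ ∃ j ∈ J, e' j ⊆ Q) ≤
        qprob p (fun Q => (e' a ⊆ Q ∧ A Q) ∧ ¬ ∃ j ∈ J, e' j ⊆ Q) := by
      refine le_of_mul_le_mul_left ?_ hs
      refine le_trans ?_ hfkg
      rw [mul_left_comm, ← mul_assoc]
      exact mul_le_mul_of_nonneg_right (h a (mem_insert_self a J)) (qprob_nonneg hp0 hp1 _)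
    have h1 := qprob_split (p := p) (fun Q => ∃ j ∈ insert a J, e' j ⊆ Q)
      (fun Q => ∃ j ∈ J, e' j ⊆ Q)
    have h2 := qprob_split (p := p) (fun Q => A Q ∧ ∃ j ∈ insert a J, e' j ⊆ Q)
      (fun Q => ∃ j ∈ J, e' j ⊆ Q)
    have h11 : (fun Q => (∃ j ∈ insert a J, e' j ⊆ Q) ∧ ∃ j ∈ J, e' j ⊆ Q) =
        fun Q => ∃ j ∈ J, e' j ⊆ Q := by
      ext Q; simp only [exists_mem_insert]
      generalize (∃ j ∈ J, e' j ⊆ Q) = X; tauto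
    have h12 : (fun Q => (∃ j ∈ insert a J, e' j ⊆ Q) ∧ ¬ ∃ j ∈ J, e' j ⊆ Q) =
        fun Q => e' a ⊆ Q ∧ ¬ ∃ j ∈ J, e' j ⊆ Q := by
      ext Q; simp only [exists_mem_insert]
      generalize (∃ j ∈ J, e' j ⊆ Q) = X; tauto
    have h21 : (fun Q => (A Q ∧ ∃ j ∈ insert a J, e' j ⊆ Q) ∧ ∃ j ∈ J, e' j ⊆ Q) =
        fun Q => A Q ∧ ∃ j ∈ J, e' j ⊆ Q := by
      ext Q; simp only [exists_mem_insert]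
      generalize (∃ j ∈ J, e' j ⊆ Q) = X; tauto
    have h22 : (fun Q => (A Q ∧ ∃ j ∈ insert a J, e' j ⊆ Q) ∧ ¬ ∃ j ∈ J, e' j ⊆ Q) =
        fun Q => (e' a ⊆ Q ∧ A Q) ∧ ¬ ∃ j ∈ J, e' j ⊆ Q := by
      ext Q; simp only [exists_mem_insert]
      generalize (∃ j ∈ J, e' j ⊆ Q) = X; tauto
    rw [h11, h12] at h1
    rw [h21, h22] at h2
    rw [h1, h2, mul_add]
    exact add_le_add ih hstep

end RandomQuery

theorem stmt9 {V : Type} [Fintype V] [DecidableEq V]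
    (r t : ℕ) (ht : 1 ≤ t)
    (e : Fin r → Finset V) (e' : Fin t → Finset V)
    (hce : ∀ i, (e i).card = 2) (hce' : ∀ j, (e' j).card = 2)
    (hinj : Function.Injective e) (hinj' : Function.Injective e')
    (hdisj : ∀ i j, e i ≠ e' j)
    (p : ℝ) (hp0 : 0 < p) (hp1 : p < 1) :
    (1 - p) ^ r ≤
      qprob p (fun Q => (∀ i, ¬ e i ⊆ Q) ∧ ∃ j, e' j ⊆ Q) /
        qprob p (fun Q => ∃ j, e' j ⊆ Q) := by
  rw [le_div_iff₀ (qprob_pos hp0 hp1 ⟨e' ⟨0, ht⟩, ⟨0, ht⟩, Subset.rfl⟩)]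
  have h := mul_qprob_exists_subset_le hp0 hp1 (c := (1 - p) ^ r) e'
    (A := fun Q => ∀ i, ¬ e i ⊆ Q) (fun Q R hQR hR i hi => hR i (hi.trans hQR)) univ
    fun j _ => by
      have := pow_mul_qprob_le_qprob_forall_not_subset hp0 hp1 e (e' j) univ fun i _ hij =>
        hdisj i j (eq_of_subset_of_card_le hij (by rw [hce, hce']))
      simpa using this
  simpa using h
end

section
/- Let G be a simple graph with at least one edge. Then: (1) for all 0 ≤ q₁ < q₂ ≤ 1, N_G(q₁) > N_G(q₂); (2) for all p₁, p₂ ∈ (0,1) with p₁ + p₂ ≤ 1, N_G(p₁ + p₂) < N_G(p₁ + p₂ − p₁p₂) ≤ N_G(p₁)·N_G(p₂); (3) for every integer k ≥ 2 and every p with 0 < p and kp ≤ 1, N_G(kp) < N_G(p)^k. -/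
open Finset
open scoped Classical

/-- `Q` is an independent set in `G`. -/
def indepIn {V : Type} (G : SimpleGraph V) (Q : Finset V) : Prop :=
  ∀ u ∈ Q, ∀ v ∈ Q, ¬ G.Adj u v

/-- `N_G(p)`: the probability that a `p`-random query is independent in `G`. -/
noncomputable def NG {V : Type} [Fintype V] (G : SimpleGraph V) (p : ℝ) : ℝ :=
  qprob p (fun Q => indepIn G Q)

section UnionOfQueries

variable {V : Type} [Fintype V]

lemma qweight_nonneg {p : ℝ} (h0 : 0 ≤ p) (h1 : p ≤ 1) (Q : Finset V) : 0 ≤ qweight p Q :=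
  mul_nonneg (pow_nonneg h0 _) (pow_nonneg (sub_nonneg.2 h1) _)

lemma sum_qweight (p : ℝ) : ∑ Q : Finset V, qweight p Q = 1 := by
  simpa [qweight] using Finset.sum_pow_mul_eq_add_pow p (1 - p) (univ : Finset V)

lemma sum_qweight_of_union_eq (r : ℝ) {A Q : Finset V} (hA : A ⊆ Q) :
    ∑ B : Finset V, (if A ∪ B = Q then qweight r B else 0) =
      r ^ (Q.card - A.card) * (1 - r) ^ (Fintype.card V - Q.card) := by
  have hbij : ∑ C ∈ A.powerset, qweight r ((Q \ A) ∪ C) =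
      ∑ B ∈ univ.filter (fun B => A ∪ B = Q), qweight r B := by
    refine Finset.sum_bij' (fun C _ => (Q \ A) ∪ C) (fun B _ => B ∩ A) ?_ ?_ ?_ ?_ ?_
    · intro C hC
      rw [mem_powerset] at hC
      simp only [mem_filter, mem_univ, true_and]
      grind
    · intro B _
      exact mem_powerset.2 inter_subset_right
    · intro C hC
      rw [mem_powerset] at hC
      grind
    · intro B hB
      simp only [mem_filter, mem_univ, true_and] at hB
      grind
    · intros
      rfl
  rw [← Finset.sum_filter, ← hbij]
  have hterm : ∀ C ∈ A.powerset, qweight r ((Q \ A) ∪ C) =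
      (r ^ (Q.card - A.card) * (1 - r) ^ (Fintype.card V - Q.card)) *
        (r ^ C.card * (1 - r) ^ (A.card - C.card)) := by
    intro C hC
    rw [mem_powerset] at hC
    have hcard : ((Q \ A) ∪ C).card = (Q.card - A.card) + C.card := by
      rw [card_union_of_disjoint (disjoint_sdiff_self_left.mono_right hC),
        card_sdiff_of_subset hA]
    have hCA := card_le_card hC
    have hAQ := card_le_card hA
    have hQ := card_le_univ Q
    have hrest : Fintype.card V - ((Q.card - A.card) + C.card) =
        (Fintype.card V - Q.card) + (A.card - C.card) := by omega
    rw [qweight, hcard, hrest, pow_add, pow_add]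
    ring
  rw [Finset.sum_congr rfl hterm, ← Finset.mul_sum, Finset.sum_pow_mul_eq_add_pow]
  simp

/-- The union of independent `p`- and `r`-random queries is a `(p + r - p * r)`-random query. -/
lemma sum_qweight_mul_qweight_of_union_eq (p r : ℝ) (Q : Finset V) :
    ∑ A : Finset V, ∑ B : Finset V, (if A ∪ B = Q then qweight p A * qweight r B else 0) =
      qweight (p + r - p * r) Q := by
  have hinner : ∀ A : Finset V,
      ∑ B : Finset V, (if A ∪ B = Q then qweight p A * qweight r B else 0) =
        if A ∈ Q.powerset then ((1 - p) * (1 - r)) ^ (Fintype.card V - Q.card) *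
          (p ^ A.card * ((1 - p) * r) ^ (Q.card - A.card)) else 0 := by
    intro A
    split_ifs with hA
    · rw [mem_powerset] at hA
      have hAQ := card_le_card hA
      have hQ := card_le_univ Q
      have hrest : Fintype.card V - A.card =
          (Fintype.card V - Q.card) + (Q.card - A.card) := by omega
      simp_rw [← mul_ite_zero]
      rw [← Finset.mul_sum, sum_qweight_of_union_eq r hA, qweight, hrest, pow_add,
        mul_pow, mul_pow]
      ring
    · refine Finset.sum_eq_zero fun B _ => if_neg fun h => hA ?_
      exact mem_powerset.2 (h ▸ subset_union_left)
  rw [Finset.sum_congr rfl fun A _ => hinner A, Finset.sum_ite_mem, univ_inter,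
    ← Finset.mul_sum, Finset.sum_pow_mul_eq_add_pow, qweight, mul_comm]
  congr 2 <;> ring

lemma qprob_union (p r : ℝ) (E : Finset V → Prop) :
    qprob (p + r - p * r) E =
      ∑ A : Finset V, ∑ B : Finset V, if E (A ∪ B) then qweight p A * qweight r B else 0 := by
  have hexpand : ∀ Q : Finset V, (if E Q then qweight (p + r - p * r) Q else 0) =
      ∑ A : Finset V, ∑ B : Finset V,
        if A ∪ B = Q then (if E Q then qweight p A * qweight r B else 0) else 0 := by
    intro Q
    split_ifs
    · exact (sum_qweight_mul_qweight_of_union_eq p r Q).symm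
    · simp
  rw [qprob, Finset.sum_congr rfl fun Q _ => hexpand Q, Finset.sum_comm]
  refine Finset.sum_congr rfl fun A _ => ?_
  rw [Finset.sum_comm]
  refine Finset.sum_congr rfl fun B _ => ?_
  rw [Finset.sum_ite_eq, if_pos (mem_univ _)]

end UnionOfQueries

section IndependentQueries

lemma indepIn.mono {V : Type} {G : SimpleGraph V} {Q R : Finset V} (hR : indepIn G R) (h : Q ⊆ R) :
    indepIn G Q :=
  fun u hu v hv => hR u (h hu) v (h hv)

variable {V : Type} [Fintype V] (G : SimpleGraph V)

lemma NG_union_le {p r : ℝ} (hp0 : 0 ≤ p) (hp1 : p ≤ 1) (hr0 : 0 ≤ r) (hr1 : r ≤ 1) :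
    NG G (p + r - p * r) ≤ NG G p * NG G r := by
  rw [NG, qprob_union, NG, NG, qprob, qprob, Finset.sum_mul_sum]
  refine Finset.sum_le_sum fun A _ => Finset.sum_le_sum fun B _ => ?_
  have hA := qweight_nonneg hp0 hp1 A
  have hB := qweight_nonneg hr0 hr1 B
  by_cases h : indepIn G (A ∪ B)
  · rw [if_pos h, if_pos (h.mono subset_union_left), if_pos (h.mono subset_union_right)]
  · rw [if_neg h]
    exact mul_nonneg (by split_ifs <;> simp [hA]) (by split_ifs <;> simp [hB])

lemma NG_nonneg {p : ℝ} (h0 : 0 ≤ p) (h1 : p ≤ 1) : 0 ≤ NG G p := by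
  refine Finset.sum_nonneg fun Q _ => ?_
  split_ifs
  exacts [qweight_nonneg h0 h1 Q, le_rfl]

lemma NG_pos {p : ℝ} (h0 : 0 ≤ p) (h1 : p < 1) : 0 < NG G p := by
  refine Finset.sum_pos' (fun Q _ => ?_) ⟨∅, mem_univ _, ?_⟩
  · split_ifs
    exacts [qweight_nonneg h0 h1.le Q, le_rfl]
  · rw [if_pos (by simp [indepIn])]
    simpa [qweight] using pow_pos (sub_pos.2 h1) _

variable {G}

lemma NG_lt_one (hE : ∃ u v : V, G.Adj u v) {p : ℝ} (h0 : 0 < p) (h1 : p ≤ 1) : NG G p < 1 := by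
  obtain ⟨u, v, huv⟩ := hE
  rw [← sum_qweight (V := V) p]
  refine Finset.sum_lt_sum (fun Q _ => ?_) ⟨univ, mem_univ _, ?_⟩
  · split_ifs
    exacts [le_rfl, qweight_nonneg h0.le h1 Q]
  · rw [if_neg fun h => h u (mem_univ _) v (mem_univ _) huv]
    simpa [qweight] using pow_pos h0 _

lemma NG_strictAntiOn (hE : ∃ u v : V, G.Adj u v) : StrictAntiOn (NG G) (Set.Icc 0 1) := by
  intro q₁ h₁ q₂ h₂ h
  have hpos : 0 < 1 - q₁ := sub_pos.2 (h.trans_le h₂.2)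
  have hr0 : 0 < (q₂ - q₁) / (1 - q₁) := div_pos (sub_pos.2 h) hpos
  have hr1 : (q₂ - q₁) / (1 - q₁) ≤ 1 := (div_le_one hpos).2 (by linarith [h₂.2])
  have hq : q₂ = q₁ + (q₂ - q₁) / (1 - q₁) - q₁ * ((q₂ - q₁) / (1 - q₁)) := by
    field_simp
    ring
  calc NG G q₂ ≤ NG G q₁ * NG G ((q₂ - q₁) / (1 - q₁)) := by
        conv_lhs => rw [hq]
        exact NG_union_le G h₁.1 h₁.2 hr0.le hr1
    _ < NG G q₁ :=
        mul_lt_of_lt_one_right (NG_pos G h₁.1 (sub_pos.1 hpos)) (NG_lt_one hE hr0 hr1)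

lemma NG_add_lt_union (hE : ∃ u v : V, G.Adj u v) {p r : ℝ} (hp : 0 < p) (hr : 0 < r)
    (h : p + r ≤ 1) : NG G (p + r) < NG G (p + r - p * r) := by
  have hpr := mul_pos hp hr
  exact NG_strictAntiOn hE ⟨by nlinarith, by linarith⟩ ⟨by positivity, h⟩ (by linarith)

lemma NG_add_lt_mul (hE : ∃ u v : V, G.Adj u v) {p r : ℝ} (hp : 0 < p) (hr : 0 < r)
    (h : p + r ≤ 1) : NG G (p + r) < NG G p * NG G r :=
  (NG_add_lt_union hE hp hr h).trans_le
    (NG_union_le G hp.le (by linarith) hr.le (by linarith))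

lemma NG_mul_lt_pow (hE : ∃ u v : V, G.Adj u v) {p : ℝ} (hp : 0 < p) {k : ℕ} (hk : 2 ≤ k)
    (h : (k : ℝ) * p ≤ 1) : NG G ((k : ℝ) * p) < NG G p ^ k := by
  induction k, hk using Nat.le_induction with
  | base =>
    have h' : p + p ≤ 1 := by
      push_cast at h
      linarith
    simpa [two_mul, sq] using NG_add_lt_mul hE hp hp h'
  | succ k hk ih =>
    have hkp : 0 < (k : ℝ) * p := mul_pos (by exact_mod_cast (by omega : 0 < k)) hp
    have hsplit : ((k + 1 : ℕ) : ℝ) * p = (k : ℝ) * p + p := by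
      push_cast
      ring
    rw [hsplit] at h ⊢
    rw [pow_succ]
    exact (NG_add_lt_mul hE hkp hp h).trans_le
      (mul_le_mul_of_nonneg_right (ih (by linarith)).le (NG_nonneg G hp.le (by linarith)))

end IndependentQueries

theorem stmt14 {V : Type} [Fintype V] [DecidableEq V]
    (G : SimpleGraph V) (hE : ∃ u v : V, G.Adj u v) :
    (∀ q₁ q₂ : ℝ, 0 ≤ q₁ → q₁ < q₂ → q₂ ≤ 1 → NG G q₂ < NG G q₁) ∧
    (∀ p₁ p₂ : ℝ, 0 < p₁ → p₁ < 1 → 0 < p₂ → p₂ < 1 → p₁ + p₂ ≤ 1 →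
      NG G (p₁ + p₂) < NG G (p₁ + p₂ - p₁ * p₂) ∧
      NG G (p₁ + p₂ - p₁ * p₂) ≤ NG G p₁ * NG G p₂) ∧
    (∀ k : ℕ, 2 ≤ k → ∀ p : ℝ, 0 < p → (k : ℝ) * p ≤ 1 → NG G ((k : ℝ) * p) < NG G p ^ k) := by
  exact ⟨fun q₁ q₂ h0 h h1 => NG_strictAntiOn hE ⟨h0, h.le.trans h1⟩ ⟨h0.trans h.le, h1⟩ h,
    fun p₁ p₂ hp₁ hp₁' hp₂ hp₂' h =>
      ⟨NG_add_lt_union hE hp₁ hp₂ h, NG_union_le G hp₁.le hp₁'.le hp₂.le hp₂'.le⟩,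
    fun k hk p hp h => NG_mul_lt_pow hE hp hk h⟩
end

section
/- Let G be a simple graph with at least one edge, let p* ∈ (0,1] satisfy N_G(p*) = 1/2, and let p' satisfy p*/8 ≤ p' ≤ p*. Let c' > 0 be a real number, let u ≠ v be vertices with {u,v} ∉ E(G) and deg_G(u) + deg_G(v) ≤ c'/p', and let Q be a p'-random query. Then the probability that u ∈ Q, v ∈ Q and Q is independent in G is at least (0.17)^{c'} · p'² / 2. -/
open Finset
open scoped Classical

/-- The expectation of `f` at a `p`-random subset of the finite set `s`. -/
noncomputable def qexpect {V : Type} (p : ℝ) (s : Finset V) (f : Finset V → ℝ) : ℝ :=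
  ∑ Q ∈ s.powerset, p ^ #Q * (1 - p) ^ (#s - #Q) * f Q

lemma qprob_eq_qexpect {V : Type} [Fintype V] (p : ℝ) (A : Finset V → Prop) :
    qprob p A = qexpect p univ (fun Q => if A Q then 1 else 0) := by
  simp [qprob, qexpect, qweight]

lemma qexpect_mono {V : Type} {p : ℝ} {f g : Finset V → ℝ} {s : Finset V}
    (hp0 : 0 ≤ p) (hp1 : p ≤ 1) (h : ∀ Q ⊆ s, f Q ≤ g Q) :
    qexpect p s f ≤ qexpect p s g := by
  have : 0 ≤ 1 - p := sub_nonneg.2 hp1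
  refine Finset.sum_le_sum fun Q hQ => ?_
  exact mul_le_mul_of_nonneg_left (h Q (Finset.mem_powerset.1 hQ)) (by positivity)

section Expect

variable {V : Type} [DecidableEq V] {p q : ℝ} {f : Finset V → ℝ} {s t : Finset V} {a : V}

lemma qexpect_insert (p : ℝ) (f : Finset V → ℝ) (ha : a ∉ s) :
    qexpect p (insert a s) f =
      (1 - p) * qexpect p s f + p * qexpect p s (fun Q => f (insert a Q)) := by
  unfold qexpect
  rw [Finset.sum_powerset_insert ha, Finset.mul_sum, Finset.mul_sum]
  congr 1 <;> refine Finset.sum_congr rfl fun Q hQ => ?_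
  · have hQ' := Finset.card_le_card (Finset.mem_powerset.1 hQ)
    rw [Finset.card_insert_of_notMem ha, Nat.sub_add_comm hQ']
    ring
  · have haQ : a ∉ Q := fun h => ha (Finset.mem_powerset.1 hQ h)
    rw [Finset.card_insert_of_notMem ha, Finset.card_insert_of_notMem haQ,
      Nat.add_sub_add_right]
    ring

lemma qexpect_const (p c : ℝ) (s : Finset V) : qexpect p s (fun _ => c) = c := by
  induction s using Finset.induction_on with
  | empty => simp [qexpect]
  | insert a s ha ih => rw [qexpect_insert p _ ha, ih]; ring

lemma qexpect_nonneg (hp0 : 0 ≤ p) (hp1 : p ≤ 1) (h : ∀ Q, 0 ≤ f Q) : 0 ≤ qexpect p s f := by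
  simpa [qexpect_const] using qexpect_mono (s := s) (f := fun _ => 0) hp0 hp1 fun Q _ => h Q

lemma qexpect_insert_le (hp0 : 0 ≤ p) (hp1 : p ≤ 1) (hf : Antitone f) (ha : a ∉ s) :
    qexpect p (insert a s) f ≤ qexpect p s f := by
  have h : qexpect p s (fun Q => f (insert a Q)) ≤ qexpect p s f :=
    qexpect_mono hp0 hp1 fun Q _ => hf (Finset.subset_insert a Q)
  rw [qexpect_insert p f ha]
  nlinarith

lemma qexpect_union_le (hp0 : 0 ≤ p) (hp1 : p ≤ 1) (hf : Antitone f) (h : Disjoint t s) :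
    qexpect p (t ∪ s) f ≤ qexpect p s f := by
  induction t using Finset.induction_on with
  | empty => simp
  | insert a t ha ih =>
    rw [Finset.disjoint_insert_left] at h
    rw [Finset.insert_union]
    exact (qexpect_insert_le hp0 hp1 hf (by simp [ha, h.1])).trans (ih h.2)

lemma pow_mul_qexpect_le_qexpect_union (hp0 : 0 ≤ p) (hp1 : p ≤ 1) (hf : ∀ Q, 0 ≤ f Q)
    (h : Disjoint t s) : (1 - p) ^ #t * qexpect p s f ≤ qexpect p (t ∪ s) f := by
  induction t using Finset.induction_on with
  | empty => simp
  | insert a t ha ih =>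
    rw [Finset.disjoint_insert_left] at h
    have hn : 0 ≤ qexpect p (t ∪ s) (fun Q => f (insert a Q)) :=
      qexpect_nonneg hp0 hp1 fun Q => hf _
    have := mul_le_mul_of_nonneg_left (ih h.2) (sub_nonneg.2 hp1)
    rw [Finset.insert_union, qexpect_insert p f (by simp [ha, h.1]),
      Finset.card_insert_of_notMem ha, pow_succ']
    nlinarith [mul_nonneg hp0 hn]

lemma mul_qexpect_le_qexpect_insert (hp0 : 0 ≤ p) (hp1 : p ≤ 1) (hf : ∀ Q, 0 ≤ f Q)
    (ha : a ∉ s) : p * qexpect p s (fun Q => f (insert a Q)) ≤ qexpect p (insert a s) f := by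
  rw [qexpect_insert p f ha]
  exact le_add_of_nonneg_left (mul_nonneg (sub_nonneg.2 hp1) (qexpect_nonneg hp0 hp1 hf))

lemma qexpect_anti_prob (hq0 : 0 ≤ q) (hqp : q ≤ p) (hp1 : p ≤ 1) (hf : Antitone f) :
    qexpect p s f ≤ qexpect q s f := by
  induction s using Finset.induction_on generalizing f with
  | empty => simp [qexpect]
  | insert a s ha ih =>
    have hf' : Antitone fun Q => f (insert a Q) :=
      fun Q R h => hf (Finset.insert_subset_insert a h)
    have h : qexpect q s (fun Q => f (insert a Q)) ≤ qexpect q s f :=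
      qexpect_mono hq0 (hqp.trans hp1) fun Q _ => hf (Finset.subset_insert a Q)
    rw [qexpect_insert p f ha, qexpect_insert q f ha]
    have h1 := mul_le_mul_of_nonneg_left (ih hf) (sub_nonneg.2 hp1)
    have h2 := mul_le_mul_of_nonneg_left (ih hf') (hq0.trans hqp)
    nlinarith [mul_le_mul_of_nonneg_left h (sub_nonneg.2 hqp)]

end Expect

lemma indepIn_mono {V : Type} {G : SimpleGraph V} {Q R : Finset V} (h : Q ⊆ R)
    (hR : indepIn G R) : indepIn G Q :=
  fun u hu v hv => hR u (h hu) v (h hv)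

lemma antitone_indepIn {V : Type} (G : SimpleGraph V) :
    Antitone fun Q : Finset V => if indepIn G Q then (1 : ℝ) else 0 := by
  intro Q R h
  dsimp only
  split_ifs with hR hQ hQ
  · exact le_rfl
  · exact absurd (indepIn_mono h hR) hQ
  · exact zero_le_one
  · exact le_rfl

lemma NG_le_one_sub_sq {V : Type} [Fintype V] {G : SimpleGraph V} {p : ℝ} {a b : V}
    (hab : G.Adj a b) (hp0 : 0 ≤ p) (hp1 : p ≤ 1) : NG G p ≤ 1 - p ^ 2 := by
  set f : Finset V → ℝ := fun Q => if indepIn G Q then 1 else 0 with hf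
  have hf1 : ∀ Q, f Q ≤ 1 := fun Q => by simp only [hf]; split_ifs <;> norm_num
  have hle (s : Finset V) (g : Finset V → ℝ) (c : ℝ) (hg : ∀ Q, g Q ≤ c) : qexpect p s g ≤ c :=
    (qexpect_mono hp0 hp1 fun Q _ => hg Q).trans_eq (qexpect_const p c s)
  have huniv : (univ : Finset V) = insert a (insert b ((univ.erase a).erase b)) := by
    rw [Finset.insert_erase (by simp [hab.ne']), Finset.insert_erase (Finset.mem_univ a)]
  have hboth : ∀ Q, f (insert a (insert b Q)) ≤ 0 := fun Q => by
    have : ¬ indepIn G (insert a (insert b Q)) := fun h =>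
      h a (by simp) b (by simp) hab
    simp [hf, this]
  rw [NG, qprob_eq_qexpect, ← hf, huniv, qexpect_insert p f (by simp [hab.ne]),
    qexpect_insert p (fun Q => f (insert a Q)) (by simp)]
  have h1 := mul_le_mul_of_nonneg_left
    (hle (insert b ((univ.erase a).erase b)) f 1 hf1) (sub_nonneg.2 hp1)
  have h2 := mul_le_mul_of_nonneg_left (mul_le_mul_of_nonneg_left
    (hle ((univ.erase a).erase b) (fun Q => f (insert a Q)) 1 fun Q => hf1 _)
    (sub_nonneg.2 hp1)) hp0
  have h3 := mul_le_mul_of_nonneg_left (mul_le_mul_of_nonneg_left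
    (hle ((univ.erase a).erase b) (fun Q => f (insert a (insert b Q))) 0 hboth) hp0) hp0
  linarith

lemma rpow_le_one_sub {p : ℝ} (hp0 : 0 ≤ p) (hp : p ≤ 5 / 7) : (0.17 : ℝ) ^ p ≤ 1 - p := by
  have h27 : (0.17 : ℝ) ≤ (2 / 7 : ℝ) ^ (7 / 5 : ℝ) := by
    refine le_of_pow_le_pow_left₀ (n := 5) (by norm_num) (by positivity) ?_
    rw [← Real.rpow_natCast, ← Real.rpow_natCast, ← Real.rpow_mul (by norm_num),
      show (7 / 5 : ℝ) * ((5 : ℕ) : ℝ) = ((7 : ℕ) : ℝ) by norm_num,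
      Real.rpow_natCast, Real.rpow_natCast]
    norm_num
  calc (0.17 : ℝ) ^ p ≤ ((2 / 7 : ℝ) ^ (7 / 5 : ℝ)) ^ p :=
        Real.rpow_le_rpow (by norm_num) h27 hp0
    _ = (1 : ℝ) ^ (1 - 7 / 5 * p) * (2 / 7 : ℝ) ^ (7 / 5 * p) := by
        rw [Real.one_rpow, one_mul, Real.rpow_mul (by norm_num)]
    _ ≤ (1 - 7 / 5 * p) * 1 + 7 / 5 * p * (2 / 7) :=
        Real.geom_mean_le_arith_mean2_weighted (by linarith) (by linarith) zero_le_one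
          (by norm_num) (by ring)
    _ = 1 - p := by ring

lemma indepIn_insert_insert {V : Type} [DecidableEq V] {G : SimpleGraph V} {u v : V}
    {Q : Finset V} (hna : ¬ G.Adj u v) (hu : ∀ w ∈ Q, ¬ G.Adj u w) (hv : ∀ w ∈ Q, ¬ G.Adj v w)
    (hQ : indepIn G Q) : indepIn G (insert u (insert v Q)) := by
  intro x hx y hy
  simp only [Finset.mem_insert] at hx hy
  rcases hx with rfl | rfl | hx <;> rcases hy with rfl | rfl | hy
  · exact G.irrefl
  · exact hna
  · exact hu y hy
  · exact fun h => hna h.symm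
  · exact G.irrefl
  · exact hv y hy
  · exact fun h => hu x hx h.symm
  · exact fun h => hv x hx h.symm
  · exact hQ x hx y hy

/-- Forcing `u` and `v` into the query and their neighbours out of it leaves a query on the
remaining vertices, which is at least as likely to be independent as one on all of `V`. -/
lemma sq_mul_pow_mul_NG_le {V : Type} [Fintype V] [DecidableEq V] {G : SimpleGraph V}
    [DecidableRel G.Adj] {p : ℝ} {u v : V} (hp0 : 0 ≤ p) (hp1 : p ≤ 1) (huv : u ≠ v)
    (hna : ¬ G.Adj u v) :
    p ^ 2 * ((1 - p) ^ (G.degree u + G.degree v) * NG G p) ≤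
      qprob p (fun Q => u ∈ Q ∧ v ∈ Q ∧ indepIn G Q) := by
  set f : Finset V → ℝ := fun Q => if u ∈ Q ∧ v ∈ Q ∧ indepIn G Q then 1 else 0 with hf
  set g : Finset V → ℝ := fun Q => if indepIn G Q then 1 else 0 with hg
  have hf0 : ∀ Q, 0 ≤ f Q := fun Q => by simp only [hf]; split_ifs <;> norm_num
  set N := G.neighborFinset u ∪ G.neighborFinset v with hN
  set R := univ \ (insert u (insert v N)) with hR
  have huN : u ∉ N := by simpa [hN] using fun h => hna h.symm
  have hvN : v ∉ N := by simpa [hN] using hna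
  have hdisj : Disjoint N R := Finset.disjoint_left.2 fun x hx => by simp [hR, hx]
  have huR : u ∉ insert v (N ∪ R) := by simp [huv, huN, hR]
  have hvR : v ∉ N ∪ R := by simp [hvN, hR]
  have huniv : insert u (insert v (N ∪ R)) = univ := by
    ext x
    simp only [hR, Finset.mem_insert, Finset.mem_union, Finset.mem_sdiff, Finset.mem_univ]
    tauto
  have hcard : #N ≤ G.degree u + G.degree v := Finset.card_union_le _ _
  have hNG : NG G p ≤ qexpect p R g := by
    rw [NG, qprob_eq_qexpect, ← hg,
      show (univ : Finset V) = insert u (insert v N) ∪ R by simp [hR]]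
    exact qexpect_union_le hp0 hp1 (antitone_indepIn G) Finset.disjoint_sdiff
  have hgf : qexpect p R g ≤ qexpect p R (fun Q => f (insert u (insert v Q))) := by
    refine qexpect_mono hp0 hp1 fun Q hQ => ?_
    by_cases h : indepIn G Q
    · have hQN : ∀ w ∈ Q, w ∉ N := fun w hw hwN =>
        Finset.disjoint_left.1 hdisj hwN (hQ hw)
      have : indepIn G (insert u (insert v Q)) := indepIn_insert_insert hna
        (fun w hw hadj => hQN w hw (by simp [hN, hadj]))
        (fun w hw hadj => hQN w hw (by simp [hN, hadj])) h
      simp [hf, hg, h, this]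
    · simpa [hg, h] using hf0 _
  have hq : 0 ≤ 1 - p := sub_nonneg.2 hp1
  have hprob : qprob p (fun Q => u ∈ Q ∧ v ∈ Q ∧ indepIn G Q) = qexpect p univ f := by
    rw [qprob_eq_qexpect]
    congr!
  rw [hprob, ← huniv]
  calc p ^ 2 * ((1 - p) ^ (G.degree u + G.degree v) * NG G p)
      ≤ p ^ 2 * ((1 - p) ^ #N * qexpect p R (fun Q => f (insert u (insert v Q)))) := by
        refine mul_le_mul_of_nonneg_left ?_ (sq_nonneg p)
        refine (mul_le_mul_of_nonneg_left (hNG.trans hgf) (by positivity)).trans ?_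
        exact mul_le_mul_of_nonneg_right
          (pow_le_pow_of_le_one hq (by linarith) hcard)
          (qexpect_nonneg hp0 hp1 fun Q => hf0 _)
    _ ≤ p ^ 2 * qexpect p (N ∪ R) (fun Q => f (insert u (insert v Q))) :=
        mul_le_mul_of_nonneg_left
          (pow_mul_qexpect_le_qexpect_union hp0 hp1 (fun Q => hf0 _) hdisj) (sq_nonneg p)
    _ = p * (p * qexpect p (N ∪ R) (fun Q => f (insert u (insert v Q)))) := by ring
    _ ≤ p * qexpect p (insert v (N ∪ R)) (fun Q => f (insert u Q)) :=
        mul_le_mul_of_nonneg_left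
          (mul_qexpect_le_qexpect_insert (f := fun Q => f (insert u Q)) hp0 hp1
            (fun Q => hf0 _) hvR) hp0
    _ ≤ qexpect p (insert u (insert v (N ∪ R))) f :=
        mul_qexpect_le_qexpect_insert hp0 hp1 hf0 huR

theorem stmt17 {V : Type} [Fintype V] [DecidableEq V]
    (G : SimpleGraph V) [DecidableRel G.Adj] (hE : ∃ a b : V, G.Adj a b)
    (pstar p' : ℝ) (hps0 : 0 < pstar) (hps1 : pstar ≤ 1) (hN : NG G pstar = 1 / 2)
    (hp'l : pstar / 8 ≤ p') (hp'u : p' ≤ pstar)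
    (c' : ℝ) (hc' : 0 < c')
    (u v : V) (huv : u ≠ v) (hna : ¬ G.Adj u v)
    (hdeg : (G.degree u : ℝ) + (G.degree v : ℝ) ≤ c' / p') :
    (0.17 : ℝ) ^ c' * p' ^ 2 / 2 ≤
      qprob p' (fun Q => u ∈ Q ∧ v ∈ Q ∧ indepIn G Q) := by
  obtain ⟨a, b, hab⟩ := hE
  have hp0 : 0 < p' := by linarith
  have hp1 : p' ≤ 1 := hp'u.trans hps1
  have hsq := NG_le_one_sub_sq hab hps0.le hps1
  have hp57 : p' ≤ 5 / 7 := by nlinarith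
  have hNG : 1 / 2 ≤ NG G p' := by
    rw [← hN, NG, NG, qprob_eq_qexpect, qprob_eq_qexpect]
    exact qexpect_anti_prob hp0.le hp'u hps1 (antitone_indepIn G)
  have hpow : (0.17 : ℝ) ^ c' ≤ (1 - p') ^ (G.degree u + G.degree v) := by
    have hle : p' * ((G.degree u + G.degree v : ℕ) : ℝ) ≤ c' := by
      push_cast
      rw [le_div_iff₀ hp0] at hdeg
      linarith
    calc (0.17 : ℝ) ^ c' ≤ (0.17 : ℝ) ^ (p' * ((G.degree u + G.degree v : ℕ) : ℝ)) :=
          Real.rpow_le_rpow_of_exponent_ge (by norm_num) (by norm_num) hle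
      _ = ((0.17 : ℝ) ^ p') ^ (G.degree u + G.degree v) :=
          Real.rpow_mul_natCast (by norm_num) _ _
      _ ≤ (1 - p') ^ (G.degree u + G.degree v) :=
          pow_le_pow_left₀ (by positivity) (rpow_le_one_sub hp0.le hp57) _
  calc (0.17 : ℝ) ^ c' * p' ^ 2 / 2 = p' ^ 2 * ((0.17 : ℝ) ^ c' * (1 / 2)) := by ring
    _ ≤ p' ^ 2 * ((1 - p') ^ (G.degree u + G.degree v) * NG G p') := by
        have : 0 ≤ 1 - p' := sub_nonneg.2 hp1
        gcongr
    _ ≤ _ := sq_mul_pow_mul_NG_le hp0.le hp1 huv hna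
end
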